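/- Let ⋆ be a homogeneous preserving semistar operation on R. Then for every nonzero finitely generated homogeneous fractional ideal F of R, F^{⋆_a} = ⋃{((FG)^⋆ : G^⋆) : G a nonzero finitely generated homogeneous fractional ideal of R} = F^{⋆_{a(h)}}. -/

import Mathlib

open Pointwise

section
/- `Γ` is a nonzero torsionless (i.e. admitting a compatible total order) cancellative
commutative monoid, `A` is an integral domain graded by `Γ` via `𝒜`, with quotient
field `K`. -/
variable {Γ : Type*} [AddCommMonoid Γ] [LinearOrder Γ]
  [CovariantClass Γ Γ (· + ·) (· < ·)] [Nontrivial Γ]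
variable {A : Type*} [CommRing A] [IsDomain A]
variable {K : Type*} [Field K] [Algebra A K] [IsFractionRing A K]

instance : SMulCommClass K A K := SMulCommClass.symm A K K

variable (𝒜 : Γ → AddSubgroup A) [GradedRing 𝒜]

/-- `a` is a nonzero homogeneous element of the graded domain `A`. -/
def IsHomog (a : A) : Prop := a ≠ 0 ∧ ∃ γ : Γ, a ∈ 𝒜 γ

/-- `x ∈ K` is a (nonzero) homogeneous element of the homogeneous quotient ring `R_H`,
i.e. `x = a/s` with `a` a nonzero homogeneous element and `s ∈ H`. -/
def IsHomogElem (x : K) : Prop :=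
  ∃ a s : A, IsHomog 𝒜 a ∧ IsHomog 𝒜 s ∧ x * algebraMap A K s = algebraMap A K a

/-- `x ∈ K` belongs to the homogeneous quotient ring `R_H`. -/
def MemRH (x : K) : Prop :=
  ∃ a s : A, IsHomog 𝒜 s ∧ x * algebraMap A K s = algebraMap A K a

/-- The image in `K` of an integral ideal of `A`. -/
def idealToK (I : Ideal A) : Submodule A K := Submodule.map (Algebra.linearMap A K) I

/-- `E` is a homogeneous fractional ideal of `A`: `sE` is (the image in `K` of) a
homogeneous integral ideal for some nonzero homogeneous `s`. -/
def IsHomogFrac (E : Submodule A K) : Prop :=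
  ∃ s : A, IsHomog 𝒜 s ∧ ∃ I : Ideal A, Ideal.IsHomogeneous 𝒜 I ∧
    algebraMap A K s • E = idealToK (K := K) I

/-- The four axioms of a semistar operation, imposed on nonzero `A`-submodules of `K`. -/
def IsSemistar (star : Submodule A K → Submodule A K) : Prop :=
  (∀ x : K, x ≠ 0 → ∀ E : Submodule A K, E ≠ ⊥ → star (x • E) = x • star E) ∧
  (∀ E F : Submodule A K, E ≠ ⊥ → E ≤ F → star E ≤ star F) ∧
  (∀ E : Submodule A K, E ≠ ⊥ → E ≤ star E) ∧
  (∀ E : Submodule A K, E ≠ ⊥ → star (star E) = star E)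

/-- `star` is homogeneous preserving. -/
def HomogPres (star : Submodule A K → Submodule A K) : Prop :=
  ∀ E : Submodule A K, E ≠ ⊥ → IsHomogFrac 𝒜 E → IsHomogFrac 𝒜 (star E)

/-- Membership in `E^{⋆_f} = ⋃ {F^⋆ : F nonzero finitely generated, F ⊆ E}`. -/
def MemStarF (star : Submodule A K → Submodule A K) (E : Submodule A K) (x : K) : Prop :=
  ∃ F : Submodule A K, F ≠ ⊥ ∧ F.FG ∧ F ≤ E ∧ x ∈ star F

/-- `star` is of finite type, i.e. `⋆ = ⋆_f`. -/
def IsFiniteType (star : Submodule A K → Submodule A K) : Prop :=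
  ∀ E : Submodule A K, E ≠ ⊥ → ∀ x : K, x ∈ star E ↔ MemStarF star E x

/-- Membership in `E^{⋆_a}`:  `F^{⋆_a} = ⋃ {((FG)^⋆ : G^⋆) : G nonzero f.g.}` for f.g. `F`,
and `E^{⋆_a} = ⋃ {F^{⋆_a} : F ⊆ E nonzero f.g.}`. -/
def MemStarA (star : Submodule A K → Submodule A K) (E : Submodule A K) (x : K) : Prop :=
  ∃ F : Submodule A K, F ≠ ⊥ ∧ F.FG ∧ F ≤ E ∧
    ∃ G : Submodule A K, G ≠ ⊥ ∧ G.FG ∧ ∀ y ∈ star G, x * y ∈ star (F * G)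

/-- Membership in `E^{⋆_{a(h)}}`: as in `⋆_a` but with `G` ranging over nonzero finitely
generated *homogeneous* fractional ideals. -/
def MemStarAH (star : Submodule A K → Submodule A K) (E : Submodule A K) (x : K) : Prop :=
  ∃ F : Submodule A K, F ≠ ⊥ ∧ F.FG ∧ F ≤ E ∧
    ∃ G : Submodule A K, G ≠ ⊥ ∧ G.FG ∧ IsHomogFrac 𝒜 G ∧ ∀ y ∈ star G, x * y ∈ star (F * G)

/-- `star` is graded-e.a.b. -/
def IsGrEab (star : Submodule A K → Submodule A K) : Prop :=
  ∀ E F G : Submodule A K,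
    E ≠ ⊥ → E.FG → IsHomogFrac 𝒜 E →
    F ≠ ⊥ → F.FG → IsHomogFrac 𝒜 F →
    G ≠ ⊥ → G.FG → IsHomogFrac 𝒜 G →
    star (E * F) ≤ star (E * G) → star F ≤ star G

/-- The `A`-submodule of `K` generated by all products `e * v`, `e ∈ E`, `v ∈ S`
(e.g. `EV` for an overring `V`). -/
def mulSet (E : Submodule A K) (S : Set K) : Submodule A K :=
  Submodule.span A {z : K | ∃ e ∈ E, ∃ v ∈ S, z = e * v}

/-- The `b`-operation: `E^b = ⋂ {EV : V a valuation overring of A}`. -/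
def bOp : Submodule A K → Submodule A K := fun E =>
  ⨅ (V : ValuationSubring K) (_ : ∀ a : A, algebraMap A K a ∈ V), mulSet E (V : Set K)

/-- The image of a polynomial over `A` in the rational function field `K(X)`. -/
noncomputable def polyToRatFunc (f : Polynomial A) : RatFunc K :=
  algebraMap (Polynomial K) (RatFunc K) (Polynomial.map (algebraMap A K) f)

/-- The content ideal `c(f)` of a polynomial. -/
def contentIdeal (f : Polynomial A) : Ideal A := Ideal.span (Set.range f.coeff)

/-- The homogeneous content ideal `𝒜_f`, generated by all homogeneous components of all
coefficients of `f`. -/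
def homogContentIdeal (f : Polynomial A) : Ideal A :=
  Ideal.span {a : A | ∃ (n : ℕ) (γ : Γ), a = (DirectSum.decompose 𝒜 (f.coeff n) γ : A)}

/-- The Kronecker function ring `Kr(R,⋆)` as a subset of `K(X)`. -/
def KrSet (star : Submodule A K → Submodule A K) : Set (RatFunc K) :=
  {q | ∃ f g h : Polynomial A, g ≠ 0 ∧ h ≠ 0 ∧
    q * polyToRatFunc (K := K) g = polyToRatFunc (K := K) f ∧
    idealToK (contentIdeal f * contentIdeal h) ≤ star (idealToK (contentIdeal g * contentIdeal h))}

/-- The homogeneous Kronecker function ring `KR(R,⋆)` as a subset of `K(X)`. -/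
def KRSet (star : Submodule A K → Submodule A K) : Set (RatFunc K) :=
  {q | ∃ f g h : Polynomial A, g ≠ 0 ∧ h ≠ 0 ∧
    q * polyToRatFunc (K := K) g = polyToRatFunc (K := K) f ∧
    idealToK (homogContentIdeal 𝒜 f * homogContentIdeal 𝒜 h) ≤
      star (idealToK (homogContentIdeal 𝒜 g * homogContentIdeal 𝒜 h))}

/-- `V` is a homogeneous overring of `A`: `R ⊆ V ⊆ R_H` and `V` is generated as an
additive group by its homogeneous elements. -/
def IsHomogOverring (V : Subring K) : Prop :=
  (∀ a : A, algebraMap A K a ∈ V) ∧ (∀ x ∈ V, MemRH 𝒜 x) ∧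
  (∀ v ∈ V, v ∈ AddSubgroup.closure {x : K | x ∈ V ∧ IsHomogElem 𝒜 x})

/-- `V` is a gr-valuation overring of `A`. -/
def IsGrValOverring (V : Subring K) : Prop :=
  IsHomogOverring 𝒜 V ∧ ∀ x : K, IsHomogElem 𝒜 x → x ∈ V ∨ x⁻¹ ∈ V

/-- `V` is a gr-`⋆`-valuation overring of `A`: `F^⋆ ⊆ FV` for every nonzero finitely
generated homogeneous fractional ideal `F`. -/
def IsGrStarValOverring (star : Submodule A K → Submodule A K) (V : Subring K) : Prop :=
  ∀ F : Submodule A K, F ≠ ⊥ → F.FG → IsHomogFrac 𝒜 F → star F ≤ mulSet F (V : Set K)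

end


theorem dvd_of_forall_pow_dvd_pow_mul {R : Type*} [CommRing R] [IsDomain R]
    [UniqueFactorizationMonoid R] {a b g : R} (hg : g ≠ 0) (h : ∀ n : ℕ, b ^ n ∣ a ^ n * g) :
    b ∣ a := by
  rcases eq_or_ne b 0 with rfl | hb
  · have := h 1
    simp_all
  obtain ⟨b', a', c, hrel, rfl, rfl⟩ :=
    UniqueFactorizationMonoid.exists_reduced_factors b hb a
  have hc : c ≠ 0 := left_ne_zero_of_mul hb
  have hunit : IsUnit b' := by
    by_contra hb'
    obtain ⟨n, hn⟩ := FiniteMultiplicity.of_not_isUnit hb' hg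
    refine hn ((hrel.pow : IsRelPrime (b' ^ (n + 1)) (a' ^ (n + 1))).dvd_of_dvd_mul_left ?_)
    have := h (n + 1)
    rwa [mul_pow, mul_pow, mul_assoc, mul_dvd_mul_iff_left (pow_ne_zero _ hc)] at this
  exact mul_dvd_mul_left c hunit.dvd

namespace AddMonoidAlgebra

/-- The inclusion of polynomials into Laurent polynomials, in several variables. -/
noncomputable def mvPolynomialToLaurent (k σ : Type*) [Field k] :
    MvPolynomial σ k →+* AddMonoidAlgebra k (σ →₀ ℤ) :=
  mapDomainRingHom k (Finsupp.mapRange.addMonoidHom (Nat.castAddMonoidHom ℤ))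

theorem mvPolynomialToLaurent_monomial {k σ : Type*} [Field k] (v : σ →₀ ℕ) (r : k) :
    mvPolynomialToLaurent k σ (MvPolynomial.monomial v r) =
      single (v.mapRange (Nat.cast : ℕ → ℤ) (by simp)) r := by
  exact mapDomain_single

theorem mvPolynomialToLaurent_injective (k σ : Type*) [Field k] :
    Function.Injective (mvPolynomialToLaurent k σ) :=
  mapDomain_injective (Finsupp.mapRange_injective _ (by simp) Nat.cast_injective)

theorem uniqueFactorizationMonoid_finsupp_int (k σ : Type*) [Field k] :
    UniqueFactorizationMonoid (AddMonoidAlgebra k (σ →₀ ℤ)) := by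
  let φ := mvPolynomialToLaurent k σ
  let : Algebra (MvPolynomial σ k) (AddMonoidAlgebra k (σ →₀ ℤ)) := φ.toAlgebra
  let M : Submonoid (MvPolynomial σ k) :=
    { carrier := {p | ∃ v, p = MvPolynomial.monomial v 1}
      one_mem' := ⟨0, rfl⟩
      mul_mem' := by
        rintro _ _ ⟨v, rfl⟩ ⟨w, rfl⟩
        exact ⟨v + w, by simp [MvPolynomial.monomial_mul]⟩ }
  have hφ : ∀ p, algebraMap (MvPolynomial σ k) (AddMonoidAlgebra k (σ →₀ ℤ)) p = φ p :=
    fun _ => rfl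
  have : IsLocalization M (AddMonoidAlgebra k (σ →₀ ℤ)) :=
    { map_units := by
        rintro ⟨_, v, rfl⟩
        rw [hφ]
        refine IsUnit.of_mul_eq_one (single (-v.mapRange (Nat.cast : ℕ → ℤ) (by simp)) 1) ?_
        rw [mvPolynomialToLaurent_monomial, single_mul_single, add_neg_cancel, mul_one, one_def]
      surj := by
        intro z
        induction z using AddMonoidAlgebra.induction_linear with
        | zero => exact ⟨(0, 1), by simp⟩
        | add x y hx hy =>
          obtain ⟨⟨p, s⟩, hp⟩ := hx
          obtain ⟨⟨q, t⟩, hq⟩ := hy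
          refine ⟨(p * t + q * s, s * t), ?_⟩
          simp only [Submonoid.coe_mul, map_mul, map_add] at hp hq ⊢
          rw [← hp, ← hq]; ring
        | single v r =>
          refine ⟨(MvPolynomial.monomial (v.mapRange Int.toNat (by simp)) r,
            ⟨MvPolynomial.monomial ((-v).mapRange Int.toNat (by simp)) 1, _, rfl⟩), ?_⟩
          rw [hφ, hφ, mvPolynomialToLaurent_monomial, mvPolynomialToLaurent_monomial,
            single_mul_single, mul_one]
          congr 1
          ext i
          simp
          omega
      exists_of_eq := by
        intro x y h
        exact ⟨1, by rw [mvPolynomialToLaurent_injective k σ h]⟩ }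
  exact UniqueFactorizationMonoid.of_isLocalization M _

theorem uniqueFactorizationMonoid_of_fg (k G : Type*) [Field k] [AddCommGroup G]
    [IsAddTorsionFree G] [Module.Finite ℤ G] :
    UniqueFactorizationMonoid (AddMonoidAlgebra k G) := by
  let e := mapDomainRingEquiv k (Module.finBasis ℤ G).repr.toAddEquiv
  have := uniqueFactorizationMonoid_finsupp_int k (Fin (Module.finrank ℤ G))
  exact e.symm.toMulEquiv.uniqueFactorizationMonoid inferInstance

theorem comapDomain_mapDomain_mul {k G : Type*} [Field k] [AddCommGroup G] (H : AddSubgroup G)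
    (x : AddMonoidAlgebra k H) (y : AddMonoidAlgebra k G) :
    comapDomain H.subtype H.subtype_injective (mapDomainRingHom k H.subtype x * y) =
      x * comapDomain H.subtype H.subtype_injective y := by
  induction x using AddMonoidAlgebra.induction_linear with
  | zero => simp
  | add x x' hx hx' => rw [map_add, add_mul, comapDomain_add, hx, hx', add_mul]
  | single h r =>
    ext g
    simp [coeff_single_mul_apply]

theorem dvd_of_forall_pow_dvd_pow_mul {k G : Type*} [Field k] [AddCommGroup G]
    [IsAddTorsionFree G] {a b g : AddMonoidAlgebra k G} (hg : g ≠ 0)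
    (h : ∀ n : ℕ, b ^ n ∣ a ^ n * g) : b ∣ a := by
  classical
  let s : Finset G := a.coeff.support ∪ b.coeff.support ∪ g.coeff.support
  let H : AddSubgroup G := AddSubgroup.closure (s : Set G)
  have hs : (s : Set G) ⊆ H := AddSubgroup.subset_closure
  have : AddGroup.FG H := (AddGroup.fg_iff_addSubgroup_fg H).2 ⟨s, rfl⟩
  have : Module.Finite ℤ H := Module.Finite.iff_addGroup_fg.2 inferInstance
  have := uniqueFactorizationMonoid_of_fg k H
  let φ := mapDomainRingHom k H.subtype
  have hlift : ∀ x : AddMonoidAlgebra k G, x.coeff.support ⊆ s → ∃ y, φ y = x := fun x hx =>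
    ⟨comapDomain H.subtype H.subtype_injective x, mapDomain_comapDomain
      (fun i hi => ⟨⟨i, hs (hx hi)⟩, rfl⟩) _⟩
  obtain ⟨a', ha'⟩ := hlift a (by intro; simp +contextual [s])
  obtain ⟨b', hb'⟩ := hlift b (by intro; simp +contextual [s])
  obtain ⟨g', hg'⟩ := hlift g (by intro; simp +contextual [s])
  rw [← ha', ← hb']
  refine map_dvd φ (_root_.dvd_of_forall_pow_dvd_pow_mul (g := g')
    (by rintro rfl; exact hg (by rw [← hg', map_zero])) fun n => ?_)
  obtain ⟨m, hm⟩ := h n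
  refine ⟨comapDomain H.subtype H.subtype_injective m, ?_⟩
  have hone : comapDomain H.subtype H.subtype_injective (1 : AddMonoidAlgebra k G) = 1 :=
    comapDomain_single_map H.subtype H.subtype_injective 0 1
  have hleft := comapDomain_mapDomain_mul H (a' ^ n * g') 1
  rw [mul_one, hone, mul_one] at hleft
  rw [← hleft, ← comapDomain_mapDomain_mul H (b' ^ n) m]
  simp only [map_mul, map_pow]
  rw [← ha', ← hb', ← hg'] at hm
  exact congrArg _ hm

end AddMonoidAlgebra

section Coaction

variable {Γ : Type*} [AddCommMonoid Γ] [LinearOrder Γ]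
variable {A : Type*} [CommRing A] (𝒜 : Γ → AddSubgroup A) [GradedRing 𝒜]
variable (B : Type*) [CommRing B] [Algebra A B]

/-- The ring homomorphism `A → B[Γ]` sending `a` to `∑ γ, a_γ X ^ γ`, where `a_γ` are the
homogeneous components of `a`. -/
noncomputable def coaction : A →+* AddMonoidAlgebra B Γ :=
  (DirectSum.toSemiring
    (fun i => (AddMonoidAlgebra.singleAddHom i).comp
      ((algebraMap A B).toAddMonoidHom.comp (𝒜 i).subtype))
    (by simp [AddMonoidAlgebra.one_def, AddMonoidAlgebra.singleAddHom])
    (by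
      intro i j a b
      simp [AddMonoidAlgebra.singleAddHom, AddMonoidAlgebra.single_mul_single])).comp
    (DirectSum.decomposeRingEquiv 𝒜).toRingHom

variable {B}

theorem coaction_of_mem {a : A} {i : Γ} (ha : a ∈ 𝒜 i) :
    coaction 𝒜 B a = AddMonoidAlgebra.single i (algebraMap A B a) := by
  rw [coaction, RingHom.comp_apply]
  change DirectSum.toSemiring _ _ _ (DirectSum.decompose 𝒜 a) = _
  rw [DirectSum.decompose_of_mem 𝒜 ha, DirectSum.toSemiring_of]
  rfl

theorem coeff_coaction (a : A) (i : Γ) :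
    (coaction 𝒜 B a).coeff i = algebraMap A B (DirectSum.decompose 𝒜 a i) := by
  induction a using DirectSum.Decomposition.inductionOn 𝒜 with
  | zero => simp
  | @homogeneous j m =>
    rw [coaction_of_mem 𝒜 m.2, AddMonoidAlgebra.coeff_single, Finsupp.single_apply]
    split_ifs with h
    · subst h
      rw [DirectSum.decompose_of_mem_same 𝒜 m.2]
    · rw [DirectSum.decompose_of_mem_ne 𝒜 m.2 h, map_zero]
  | add m m' hm hm' => simp [hm, hm', DirectSum.decompose_add]

theorem coaction_injective (h : Function.Injective (algebraMap A B)) :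
    Function.Injective (coaction 𝒜 B) := by
  intro a b hab
  apply (DirectSum.decompose 𝒜).injective
  ext i
  apply h
  rw [← coeff_coaction, ← coeff_coaction, hab]

end Coaction

namespace AddMonoidAlgebra

/-- The leading coefficient of a product is the product of the leading coefficients. -/
theorem coeff_mul_add_max {Γ R : Type*} [AddCommMonoid Γ] [LinearOrder Γ]
    [IsOrderedCancelAddMonoid Γ] [CommRing R] (f g : AddMonoidAlgebra R Γ)
    (hf : f.coeff.support.Nonempty) (hg : g.coeff.support.Nonempty) :
    (f * g).coeff (f.coeff.support.max' hf + g.coeff.support.max' hg) =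
      f.coeff (f.coeff.support.max' hf) * g.coeff (g.coeff.support.max' hg) := by
  apply coeff_mul_add_of_uniqueAdd
  intro a b ha hb hab
  exact (add_eq_add_iff_eq_and_eq (Finset.le_max' _ _ ha) (Finset.le_max' _ _ hb)).1 hab

theorem card_support_erase_lt {Γ R : Type*} [Semiring R] (f : AddMonoidAlgebra R Γ) {m : Γ}
    (hm : m ∈ f.coeff.support) :
    (f.erase m).coeff.support.card < f.coeff.support.card := by
  classical
  rw [coeff_erase, Finsupp.support_erase]
  exact Finset.card_erase_lt_of_mem hm

/-- Every element of `k[G]`, with `G` the group of differences of `Γ`, has a monomial multiple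
coming from `k[Γ]`. -/
theorem exists_single_mul_eq_mapDomain {Γ k : Type*} [AddCommMonoid Γ] [Field k]
    (q : AddMonoidAlgebra k (Algebra.GrothendieckAddGroup Γ)) :
    ∃ (σ : Γ) (p : AddMonoidAlgebra k Γ), mapDomainRingHom k Algebra.GrothendieckAddGroup.of p =
      single (Algebra.GrothendieckAddGroup.of σ) 1 * q := by
  induction q using AddMonoidAlgebra.induction_linear with
  | zero => exact ⟨0, 0, by simp⟩
  | add x y hx hy =>
    obtain ⟨σ, p, hp⟩ := hx
    obtain ⟨τ, r, hr⟩ := hy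
    refine ⟨σ + τ, single τ 1 * p + single σ 1 * r, ?_⟩
    have hsingle : ∀ ρ : Γ, mapDomainRingHom k Algebra.GrothendieckAddGroup.of (single ρ (1 : k)) =
        single (Algebra.GrothendieckAddGroup.of ρ) 1 := fun ρ => mapDomain_single
    have hadd : (single (Algebra.GrothendieckAddGroup.of (σ + τ)) 1 :
        AddMonoidAlgebra k (Algebra.GrothendieckAddGroup Γ)) =
        single (Algebra.GrothendieckAddGroup.of σ) 1 *
          single (Algebra.GrothendieckAddGroup.of τ) 1 := by
      rw [single_mul_single, map_add, mul_one]
    rw [map_add, map_mul, map_mul, hp, hr, hsingle, hsingle, hadd]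
    ring
  | single v r =>
    obtain ⟨⟨m, s⟩, hm⟩ := (AddLocalization.addMonoidOf (⊤ : AddSubmonoid Γ)).surj v
    refine ⟨s, single m r, ?_⟩
    rw [single_mul_single, one_mul, add_comm]
    refine Eq.trans mapDomain_single ?_
    exact congrArg (fun x => single x r) hm.symm

end AddMonoidAlgebra

section HomogeneousQuotient

variable {Γ : Type*} [AddCommMonoid Γ] [LinearOrder Γ] [IsOrderedCancelAddMonoid Γ]
variable {A : Type*} [CommRing A] [IsDomain A]
variable {K : Type*} [Field K] [Algebra A K] [IsFractionRing A K]
variable (𝒜 : Γ → AddSubgroup A) [GradedRing 𝒜]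

open AddMonoidAlgebra in
theorem memRH_div_of_coaction_mul_eq {b : A} (hb : b ≠ 0) (n : ℕ) :
    ∀ (q : AddMonoidAlgebra K Γ) (σ : Γ) (a : A), q.coeff.support.card = n →
      coaction 𝒜 K b * q = single σ 1 * coaction 𝒜 K a →
      MemRH 𝒜 (algebraMap A K a / algebraMap A K b) := by
  induction n using Nat.strong_induction_on with
  | _ n ih =>
  intro q σ a hn hq
  have hinj := coaction_injective 𝒜 (IsFractionRing.injective A K)
  have hbK : algebraMap A K b ≠ 0 := by
    simpa using (IsFractionRing.injective A K).ne hb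
  rcases eq_or_ne q 0 with rfl | hq0
  · have : coaction 𝒜 K a = 0 := by
      have h := hq
      rw [mul_zero, eq_comm, mul_eq_zero] at h
      exact h.resolve_left (by simp [single_eq_zero])
    have ha : a = 0 := hinj (by rw [this, map_zero])
    exact ⟨0, 1, ⟨one_ne_zero, 0, SetLike.one_mem_graded 𝒜⟩, by simp [ha]⟩
  have hδb : (coaction 𝒜 K b).coeff.support.Nonempty := by
    rw [Finsupp.support_nonempty_iff, Ne, coeff_eq_zero]
    exact fun h => hb (hinj (by rw [h, map_zero]))
  have hqs : q.coeff.support.Nonempty := by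
    rwa [Finsupp.support_nonempty_iff, Ne, coeff_eq_zero]
  have htop := coeff_mul_add_max (coaction 𝒜 K b) q hδb hqs
  have hβ := Finset.max'_mem _ hδb
  have hμ := Finset.max'_mem _ hqs
  set β := (coaction 𝒜 K b).coeff.support.max' hδb
  set μ := q.coeff.support.max' hqs
  have hα : ∃ α, σ + α = β + μ := by
    by_contra! h
    rw [hq, coeff_single_mul_of_forall_add_ne _ _ h] at htop
    exact mul_ne_zero (Finsupp.mem_support_iff.1 hβ) (Finsupp.mem_support_iff.1 hμ) htop.symm
  obtain ⟨α, hα⟩ := hα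
  rw [hq, ← hα, coeff_single_mul_add, one_mul, coeff_coaction, coeff_coaction] at htop
  rw [Finsupp.mem_support_iff, coeff_coaction] at hβ
  obtain ⟨bβ, hbmem, hbβ⟩ : ∃ c ∈ 𝒜 β, (DirectSum.decompose 𝒜 b β : A) = c :=
    ⟨_, SetLike.coe_mem _, rfl⟩
  obtain ⟨aα, hamem, haα⟩ : ∃ c ∈ 𝒜 α, (DirectSum.decompose 𝒜 a α : A) = c :=
    ⟨_, SetLike.coe_mem _, rfl⟩
  rw [hbβ] at htop hβ
  rw [haα] at htop
  have hcard : (single β (algebraMap A K bβ) * q.erase μ).coeff.support.card < n := by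
    refine lt_of_le_of_lt ?_ (hn ▸ card_support_erase_lt q hμ)
    exact (Finset.card_le_card (support_coeff_single_mul_subset _ _ _)).trans Finset.card_image_le
  obtain ⟨c, s, ⟨hs0, i, hs⟩, hc⟩ := ih _ hcard _ σ (bβ * a - aα * b) rfl <| by
    have herase : q.erase μ = q - single μ (q.coeff μ) := eq_sub_of_add_eq (erase_add_single μ q)
    have hmono : single β (algebraMap A K bβ) * single μ (q.coeff μ) =
        single σ 1 * single α (algebraMap A K aα) := by
      rw [single_mul_single, single_mul_single, hα, one_mul, htop]
    rw [herase, map_sub, map_mul, map_mul, coaction_of_mem 𝒜 hbmem, coaction_of_mem 𝒜 hamem]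
    linear_combination single β (algebraMap A K bβ) * hq - coaction 𝒜 K b * hmono
  have hbβ0 : bβ ≠ 0 := by rintro rfl; simp at hβ
  refine ⟨c + aα * s, bβ * s, ⟨mul_ne_zero hbβ0 hs0, β + i, SetLike.mul_mem_graded hbmem hs⟩, ?_⟩
  rw [div_mul_eq_mul_div, div_eq_iff hbK] at hc ⊢
  simp only [map_sub, map_mul, map_add] at hc ⊢
  linear_combination hc

open AddMonoidAlgebra in
/-- The homogeneous quotient ring is completely integrally closed. -/
theorem memRH_of_forall_pow_mul {x : K} {g : A} (hg : g ≠ 0)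
    (h : ∀ n : ℕ, MemRH 𝒜 (x ^ n * algebraMap A K g)) : MemRH 𝒜 x := by
  have hinjK := IsFractionRing.injective A K
  obtain ⟨a, b, hb, rfl⟩ := IsFractionRing.div_surjective (A := A) x
  have hb0 := nonZeroDivisors.ne_zero hb
  have hbK : algebraMap A K b ≠ 0 := by simpa using hinjK.ne hb0
  have hof : Function.Injective (Algebra.GrothendieckAddGroup.of (M := Γ)) :=
    Algebra.GrothendieckAddGroup.of_injective
  have hjinj : Function.Injective
      (mapDomainRingHom K (Algebra.GrothendieckAddGroup.of (M := Γ))) := mapDomain_injective hof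
  set j := mapDomainRingHom K (Algebra.GrothendieckAddGroup.of (M := Γ))
  let φ := j.comp (coaction 𝒜 K)
  have hφinj : Function.Injective φ := hjinj.comp (coaction_injective 𝒜 hinjK)
  have hdvd : φ b ∣ φ a := by
    refine AddMonoidAlgebra.dvd_of_forall_pow_dvd_pow_mul (g := φ g)
      (by rw [← map_zero φ]; exact hφinj.ne hg) fun n => ?_
    obtain ⟨p, s, ⟨hs0, i, hs⟩, hp⟩ := h n
    have hA : a ^ n * g * s = b ^ n * p := by
      apply hinjK
      simp only [map_mul, map_pow]
      rw [← hp, div_pow]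
      field_simp
    have hunit : IsUnit (φ s) := by
      have hsK : algebraMap A K s ≠ 0 := by simpa using hinjK.ne hs0
      have hφs : φ s = single (Algebra.GrothendieckAddGroup.of i) (algebraMap A K s) := by
        change j (coaction 𝒜 K s) = _
        rw [coaction_of_mem 𝒜 hs]
        exact mapDomain_single
      refine IsUnit.of_mul_eq_one
        (single (-Algebra.GrothendieckAddGroup.of i) (algebraMap A K s)⁻¹) ?_
      rw [hφs, single_mul_single, add_neg_cancel, mul_inv_cancel₀ hsK, one_def]
    rw [← hunit.dvd_mul_right]
    exact ⟨φ p, by simp only [← map_mul, ← map_pow, hA]⟩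
  obtain ⟨q, hq⟩ := hdvd
  obtain ⟨σ, p, hp⟩ := exists_single_mul_eq_mapDomain q
  refine memRH_div_of_coaction_mul_eq 𝒜 hb0 _ p σ a rfl (hjinj ?_)
  rw [map_mul, map_mul, hp]
  have hsingle : j (single σ 1) = single (Algebra.GrothendieckAddGroup.of σ) 1 := mapDomain_single
  change φ b * _ = _ * φ a
  rw [hq, hsingle]
  ring

end HomogeneousQuotient

namespace AddMonoidAlgebra

section Content

variable {Γ R : Type*} [CommRing R]

/-- The ideal generated by the coefficients of an element of a monoid algebra. -/
def contentIdeal (f : AddMonoidAlgebra R Γ) : Ideal R := Ideal.span (Set.range f.coeff)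

theorem coeff_mem_contentIdeal (f : AddMonoidAlgebra R Γ) (m : Γ) :
    f.coeff m ∈ f.contentIdeal :=
  Ideal.subset_span ⟨m, rfl⟩

theorem contentIdeal_le_iff {f : AddMonoidAlgebra R Γ} {I : Ideal R} :
    f.contentIdeal ≤ I ↔ ∀ m, f.coeff m ∈ I := by
  rw [contentIdeal, Ideal.span_le, Set.range_subset_iff]
  rfl

theorem contentIdeal_fg (f : AddMonoidAlgebra R Γ) : f.contentIdeal.FG := by
  classical
  refine Submodule.fg_span ((f.coeff.support.image f.coeff ∪ {0}).finite_toSet.subset ?_)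
  rintro _ ⟨m, rfl⟩
  by_cases h : f.coeff m = 0
  · simp [h]
  · simp only [Finset.coe_union, Finset.coe_image, Set.mem_union]
    exact Or.inl ⟨m, by simpa using h, rfl⟩

theorem contentIdeal_sub_le (f g : AddMonoidAlgebra R Γ) :
    (f - g).contentIdeal ≤ f.contentIdeal + g.contentIdeal :=
  contentIdeal_le_iff.2 fun m => by
    rw [coeff_sub]
    exact sub_mem (Ideal.mem_sup_left (coeff_mem_contentIdeal f m))
      (Ideal.mem_sup_right (coeff_mem_contentIdeal g m))

theorem contentIdeal_single_le (m : Γ) (r : R) :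
    (single m r).contentIdeal ≤ Ideal.span {r} := by
  classical
  refine contentIdeal_le_iff.2 fun m' => ?_
  rw [coeff_single, Finsupp.single_apply]
  split_ifs
  · exact Ideal.mem_span_singleton_self r
  · exact zero_mem _

theorem contentIdeal_erase_le (f : AddMonoidAlgebra R Γ) (m : Γ) :
    (f.erase m).contentIdeal ≤ f.contentIdeal := by
  classical
  refine contentIdeal_le_iff.2 fun m' => ?_
  rw [coeff_erase, Finsupp.erase_apply]
  split_ifs
  · exact zero_mem _
  · exact coeff_mem_contentIdeal f m'

theorem contentIdeal_le_erase_add (f : AddMonoidAlgebra R Γ) (m : Γ) :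
    f.contentIdeal ≤ (f.erase m).contentIdeal + Ideal.span {f.coeff m} := by
  classical
  refine contentIdeal_le_iff.2 fun m' => ?_
  by_cases h : m' = m
  · subst h
    exact Ideal.mem_sup_right (Ideal.mem_span_singleton_self _)
  · refine Ideal.mem_sup_left ?_
    have := coeff_mem_contentIdeal (f.erase m) m'
    rwa [coeff_erase, Finsupp.erase_ne h] at this

variable [AddCommMonoid Γ]

theorem contentIdeal_mul_le (f g : AddMonoidAlgebra R Γ) :
    (f * g).contentIdeal ≤ f.contentIdeal * g.contentIdeal := by
  classical
  refine contentIdeal_le_iff.2 fun m => ?_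
  rw [coeff_mul]
  refine Submodule.sum_mem _ fun i _ => Submodule.sum_mem _ fun j _ => ?_
  dsimp only
  split_ifs
  · exact Ideal.mul_mem_mul (coeff_mem_contentIdeal f i) (coeff_mem_contentIdeal g j)
  · exact zero_mem _

theorem pow_succ_mul_le_of_le {F G P : Ideal R} {m n : ℕ} (hmn : m ≤ n)
    (h : F ^ (m + 1) * G ≤ F ^ m * P) : F ^ (n + 1) * G ≤ F ^ n * P := by
  obtain ⟨k, rfl⟩ := Nat.exists_eq_add_of_le hmn
  calc F ^ (m + k + 1) * G = F ^ k * (F ^ (m + 1) * G) := by ring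
    _ ≤ F ^ k * (F ^ m * P) := Ideal.mul_mono_right h
    _ = F ^ (m + k) * P := by ring

theorem pow_succ_le_add_of_le_add {F F' T : Ideal R} (hF' : F' ≤ F) (hF : F ≤ F' + T) (n : ℕ) :
    F ^ (n + 1) ≤ F' ^ (n + 1) + T * F ^ n := by
  induction n with
  | zero => simpa using hF
  | succ n ih =>
    calc F ^ (n + 1 + 1) = F * F ^ (n + 1) := by ring
      _ ≤ (F' + T) * F ^ (n + 1) := Ideal.mul_mono_left hF
      _ = F' * F ^ (n + 1) + T * F ^ (n + 1) := by ring
      _ ≤ F' * (F' ^ (n + 1) + T * F ^ n) + T * F ^ (n + 1) :=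
        sup_le_sup_right (Ideal.mul_mono_right ih) _
      _ = F' ^ (n + 1 + 1) + (T * (F' * F ^ n) + T * F ^ (n + 1)) := by ring
      _ ≤ F' ^ (n + 1 + 1) + (T * (F * F ^ n) + T * F ^ (n + 1)) :=
        sup_le_sup_left (sup_le_sup_right
          (Ideal.mul_mono_right (Ideal.mul_mono_left hF')) _) _
      _ = F' ^ (n + 1 + 1) + T * F ^ (n + 1) := by
        rw [← pow_succ', Submodule.add_eq_sup (T * _), sup_idem]

/-- The inductive step of the Dedekind–Mertens lemma, at the level of ideals. -/
theorem pow_succ_mul_le_of_erase {F F' T G G' U P P₁ P₂ : Ideal R} {m n : ℕ}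
    (hF' : F' ≤ F) (hT : T ≤ F) (hF : F ≤ F' + T) (hG : G ≤ G' + U) (hTU : T * U ≤ P)
    (hP₁ : P₁ ≤ P + F * U) (hP₂ : P₂ ≤ P + T * G)
    (h₁ : F ^ (m + 1) * G' ≤ F ^ m * P₁) (h₂ : F' ^ (n + 1) * G ≤ F' ^ n * P₂) :
    F ^ (m + 1 + n + 1) * G ≤ F ^ (m + 1 + n) * P := by
  have hA : T * F ^ (m + 1) * G ≤ F ^ (m + 1) * P := by
    calc T * F ^ (m + 1) * G ≤ T * F ^ (m + 1) * (G' + U) := Ideal.mul_mono_right hG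
      _ = T * (F ^ (m + 1) * G') + F ^ (m + 1) * (T * U) := by ring
      _ ≤ T * (F ^ m * (P + F * U)) + F ^ (m + 1) * (T * U) :=
        sup_le_sup_right (Ideal.mul_mono_right (h₁.trans (Ideal.mul_mono_right hP₁))) _
      _ = T * (F ^ m * P) + (F ^ (m + 1) * (T * U) + F ^ (m + 1) * (T * U)) := by ring
      _ ≤ F ^ (m + 1) * P := by
        refine sup_le ?_ (sup_le (Ideal.mul_mono_right hTU) (Ideal.mul_mono_right hTU))
        rw [pow_succ', mul_assoc]
        exact Ideal.mul_mono_left hT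
  have hA' : T * F ^ (m + 1 + n) * G ≤ F ^ (m + 1 + n) * P := by
    calc T * F ^ (m + 1 + n) * G = F ^ n * (T * F ^ (m + 1) * G) := by ring
      _ ≤ F ^ n * (F ^ (m + 1) * P) := Ideal.mul_mono_right hA
      _ = F ^ (m + 1 + n) * P := by ring
  have hpow : F' ^ (m + 1 + n) ≤ F ^ (m + 1 + n) := Ideal.pow_right_mono hF' _
  have hB : F' ^ (m + 1 + n + 1) * G ≤ F ^ (m + 1 + n) * P := by
    calc F' ^ (m + 1 + n + 1) * G ≤ F' ^ (m + 1 + n) * P₂ :=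
          pow_succ_mul_le_of_le (Nat.le_add_left _ _) h₂
      _ ≤ F ^ (m + 1 + n) * (P + T * G) := Ideal.mul_mono hpow hP₂
      _ = F ^ (m + 1 + n) * P + T * F ^ (m + 1 + n) * G := by ring
      _ ≤ F ^ (m + 1 + n) * P := sup_le le_rfl hA'
  calc F ^ (m + 1 + n + 1) * G ≤ (F' ^ (m + 1 + n + 1) + T * F ^ (m + 1 + n)) * G :=
        Ideal.mul_mono_left (pow_succ_le_add_of_le_add hF' hF _)
    _ = F' ^ (m + 1 + n + 1) * G + T * F ^ (m + 1 + n) * G := by ring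
    _ ≤ F ^ (m + 1 + n) * P := sup_le hB hA'

/-- A form of the **Dedekind–Mertens lemma** for monoid algebras over ordered monoids. -/
theorem exists_contentIdeal_pow_succ_mul_le [LinearOrder Γ] [IsOrderedCancelAddMonoid Γ]
    (f g : AddMonoidAlgebra R Γ) :
    ∃ n : ℕ, f.contentIdeal ^ (n + 1) * g.contentIdeal ≤
      f.contentIdeal ^ n * (f * g).contentIdeal := by
  induction hN : f.coeff.support.card + g.coeff.support.card using Nat.strong_induction_on
    generalizing f g with
  | _ N ih =>
  have hzero : (0 : AddMonoidAlgebra R Γ).contentIdeal = ⊥ :=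
    le_bot_iff.1 (contentIdeal_le_iff.2 fun m => by simp)
  rcases eq_or_ne f 0 with rfl | hf
  · exact ⟨0, by simp [hzero]⟩
  rcases eq_or_ne g 0 with rfl | hg
  · exact ⟨0, by simp [hzero]⟩
  have hfs : f.coeff.support.Nonempty := by
    rwa [Finsupp.support_nonempty_iff, Ne, coeff_eq_zero]
  have hgs : g.coeff.support.Nonempty := by
    rwa [Finsupp.support_nonempty_iff, Ne, coeff_eq_zero]
  have htop := coeff_mul_add_max f g hfs hgs
  have hcardf := card_support_erase_lt f (Finset.max'_mem _ hfs)
  have hcardg := card_support_erase_lt g (Finset.max'_mem _ hgs)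
  set β := f.coeff.support.max' hfs
  set μ := g.coeff.support.max' hgs
  obtain ⟨m, hm⟩ := ih _ (by omega) f (g.erase μ) rfl
  obtain ⟨n, hn⟩ := ih _ (by omega) (f.erase β) g rfl
  refine ⟨m + 1 + n, pow_succ_mul_le_of_erase (contentIdeal_erase_le f β)
    ((Ideal.span_singleton_le_iff_mem _).2 (coeff_mem_contentIdeal f β))
    (contentIdeal_le_erase_add f β) (contentIdeal_le_erase_add g μ) ?_ ?_ ?_ hm hn⟩
  · rw [Ideal.span_singleton_mul_span_singleton, Ideal.span_singleton_le_iff_mem, ← htop]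
    exact coeff_mem_contentIdeal _ _
  · rw [eq_sub_of_add_eq (erase_add_single μ g), mul_sub]
    refine (contentIdeal_sub_le _ _).trans (sup_le_sup_left ?_ _)
    exact (contentIdeal_mul_le _ _).trans (Ideal.mul_mono_right (contentIdeal_single_le _ _))
  · rw [eq_sub_of_add_eq (erase_add_single β f), sub_mul]
    refine (contentIdeal_sub_le _ _).trans (sup_le_sup_left ?_ _)
    exact (contentIdeal_mul_le _ _).trans (Ideal.mul_mono_left (contentIdeal_single_le _ _))

end Content

end AddMonoidAlgebra

section HomogeneousContent

variable {Γ : Type*} [AddCommMonoid Γ] [LinearOrder Γ]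
variable {A : Type*} [CommRing A] (𝒜 : Γ → AddSubgroup A) [GradedRing 𝒜]

theorem isHomogeneous_contentIdeal_coaction (a : A) :
    (coaction 𝒜 A a).contentIdeal.IsHomogeneous 𝒜 := by
  refine Ideal.homogeneous_span 𝒜 _ ?_
  rintro _ ⟨m, rfl⟩
  rw [coeff_coaction]
  exact ⟨m, SetLike.coe_mem _⟩

theorem mem_contentIdeal_coaction (a : A) : a ∈ (coaction 𝒜 A a).contentIdeal := by
  classical
  have h : ∑ i ∈ (DirectSum.decompose 𝒜 a).support, (DirectSum.decompose 𝒜 a i : A) ∈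
      (coaction 𝒜 A a).contentIdeal := by
    refine Ideal.sum_mem _ fun i _ => ?_
    have hi := AddMonoidAlgebra.coeff_mem_contentIdeal (coaction 𝒜 A a) i
    rwa [coeff_coaction] at hi
  rwa [DirectSum.sum_support_decompose] at h

theorem contentIdeal_coaction_ne_bot {a : A} (ha : a ≠ 0) :
    (coaction 𝒜 A a).contentIdeal ≠ ⊥ :=
  (Submodule.ne_bot_iff _).2 ⟨a, mem_contentIdeal_coaction 𝒜 a, ha⟩

theorem decompose_mul_add_of_mem [IsOrderedCancelAddMonoid Γ] {t : A} {τ : Γ} (ht : t ∈ 𝒜 τ)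
    (c : A) (γ : Γ) :
    (DirectSum.decompose 𝒜 (t * c) (τ + γ) : A) = t * DirectSum.decompose 𝒜 c γ := by
  have h : (coaction 𝒜 A (t * c)).coeff (τ + γ) = t * (coaction 𝒜 A c).coeff γ := by
    rw [map_mul, coaction_of_mem 𝒜 ht, AddMonoidAlgebra.coeff_single_mul_add]
    rfl
  simpa only [coeff_coaction, Algebra.algebraMap_self_apply] using h

theorem exists_forall_contentIdeal_pow_succ_mul_le [IsOrderedCancelAddMonoid Γ]
    (a : A) (t : Finset A) :
    ∃ N : ℕ, ∀ g ∈ t,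
      (coaction 𝒜 A a).contentIdeal ^ (N + 1) * (coaction 𝒜 A g).contentIdeal ≤
        (coaction 𝒜 A a).contentIdeal ^ N * (coaction 𝒜 A (a * g)).contentIdeal := by
  choose n hn using fun g => AddMonoidAlgebra.exists_contentIdeal_pow_succ_mul_le
    (coaction 𝒜 A a) (coaction 𝒜 A g)
  refine ⟨t.sup n, fun g hg => ?_⟩
  rw [map_mul]
  exact AddMonoidAlgebra.pow_succ_mul_le_of_le (Finset.le_sup hg) (hn g)

theorem Ideal.IsHomogeneous.pow {I : Ideal A} (hI : I.IsHomogeneous 𝒜) (n : ℕ) :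
    (I ^ n).IsHomogeneous 𝒜 := by
  induction n with
  | zero => simpa using Ideal.IsHomogeneous.top 𝒜
  | succ n ih => exact pow_succ I n ▸ ih.mul hI

end HomogeneousContent

section Submodules

variable {A : Type*} [CommRing A] {K : Type*} [Field K] [Algebra A K]

theorem smul_mul_eq_mul_smul (x : K) (E F : Submodule A K) : x • (E * F) = E * (x • F) := by
  rw [← Submodule.span_singleton_mul, ← Submodule.span_singleton_mul, mul_left_comm]

theorem mul_smul_mul_eq (x y : K) (E F : Submodule A K) :
    (x * y) • (E * F) = (x • E) * (y • F) := by
  rw [mul_smul, smul_mul_eq_mul_smul y, mul_comm E, smul_mul_eq_mul_smul x, mul_comm]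

theorem smul_le_mul_of_mem {x : K} {E : Submodule A K} (hx : x ∈ E) (F : Submodule A K) :
    x • F ≤ E * F := by
  rw [← Submodule.span_singleton_mul]
  exact mul_le_mul_left ((Submodule.span_singleton_le_iff_mem x E).2 hx) F

theorem smul_submodule_ne_bot {x : K} (hx : x ≠ 0) {E : Submodule A K} (hE : E ≠ ⊥) :
    x • E ≠ ⊥ := by
  obtain ⟨e, he, he0⟩ := (Submodule.ne_bot_iff _).1 hE
  exact (Submodule.ne_bot_iff _).2
    ⟨x * e, Submodule.smul_mem_pointwise_smul e x E he, mul_ne_zero hx he0⟩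

theorem mul_submodule_ne_bot {E F : Submodule A K} (hE : E ≠ ⊥) (hF : F ≠ ⊥) : E * F ≠ ⊥ := by
  obtain ⟨e, he, he0⟩ := (Submodule.ne_bot_iff _).1 hE
  exact ne_bot_of_le_ne_bot (smul_submodule_ne_bot he0 hF) (smul_le_mul_of_mem he F)

theorem pow_submodule_ne_bot {E : Submodule A K} (hE : E ≠ ⊥) (n : ℕ) : E ^ n ≠ ⊥ := by
  induction n with
  | zero =>
    rw [pow_zero]
    exact (Submodule.ne_bot_iff _).2 ⟨1, Submodule.one_le.1 le_rfl, one_ne_zero⟩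
  | succ n ih => exact pow_succ E n ▸ mul_submodule_ne_bot ih hE

theorem smul_le_smul_iff_of_ne_zero {x : K} (hx : x ≠ 0) {E F : Submodule A K} :
    x • E ≤ x • F ↔ E ≤ F := by
  refine ⟨fun h y hy => ?_, fun h => Submodule.map_mono h⟩
  obtain ⟨z, hz, hzy⟩ := h (Submodule.smul_mem_pointwise_smul y x E hy)
  have hzy : x * z = x * y := hzy
  exact mul_left_cancel₀ hx hzy ▸ hz

theorem idealToK_mul (I J : Ideal A) :
    idealToK (K := K) (I * J) = idealToK I * idealToK J :=
  IsLocalization.coeSubmodule_mul K I J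

theorem idealToK_mono {I J : Ideal A} (h : I ≤ J) : idealToK (K := K) I ≤ idealToK J :=
  Submodule.map_mono h

theorem idealToK_top : idealToK (K := K) (⊤ : Ideal A) = 1 :=
  IsLocalization.coeSubmodule_top K

theorem idealToK_span_singleton (a : A) :
    idealToK (K := K) (Ideal.span {a}) = Submodule.span A {algebraMap A K a} :=
  IsLocalization.coeSubmodule_span_singleton K a

theorem idealToK_span_singleton_mul (a : A) (I : Ideal A) :
    idealToK (K := K) (Ideal.span {a} * I) = algebraMap A K a • idealToK I := by
  rw [idealToK_mul, idealToK_span_singleton, Submodule.span_singleton_mul]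

theorem algebraMap_mem_idealToK {a : A} {I : Ideal A} (ha : a ∈ I) :
    algebraMap A K a ∈ idealToK (K := K) I :=
  ⟨a, ha, rfl⟩

variable [IsFractionRing A K]

theorem mem_of_algebraMap_mem_idealToK {a : A} {I : Ideal A}
    (ha : algebraMap A K a ∈ idealToK (K := K) I) : a ∈ I := by
  obtain ⟨b, hb, hba⟩ := ha
  exact IsFractionRing.injective A K hba ▸ hb

variable [IsDomain A]

theorem algebraMap_ne_zero_of_ne_zero {a : A} (ha : a ≠ 0) : algebraMap A K a ≠ 0 := by
  simpa using (IsFractionRing.injective A K).ne ha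

theorem idealToK_ne_bot {I : Ideal A} (hI : I ≠ ⊥) : idealToK (K := K) I ≠ ⊥ := by
  obtain ⟨a, ha, ha0⟩ := (Submodule.ne_bot_iff _).1 hI
  exact (Submodule.ne_bot_iff _).2
    ⟨_, algebraMap_mem_idealToK ha, algebraMap_ne_zero_of_ne_zero ha0⟩

/-- A finitely generated submodule of the quotient field becomes an integral ideal after scaling. -/
theorem exists_smul_eq_idealToK_span {G : Submodule A K} (hG : G.FG) :
    ∃ d : A, d ≠ 0 ∧ ∃ t : Finset A,
      algebraMap A K d • G = idealToK (Ideal.span (t : Set A)) := by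
  obtain ⟨d, hd, hdG⟩ := FractionalIdeal.isFractional_of_fg (S := nonZeroDivisors A) hG
  have hle : algebraMap A K d • G ≤ LinearMap.range (Algebra.linearMap A K) := by
    rintro _ ⟨y, hy, rfl⟩
    obtain ⟨z, hz⟩ := hdG y hy
    exact ⟨z, by simpa [Algebra.smul_def] using hz⟩
  have hmap : ((algebraMap A K d • G).comap (Algebra.linearMap A K)).map (Algebra.linearMap A K) =
      algebraMap A K d • G := Submodule.map_comap_eq_self hle
  have hfg : ((algebraMap A K d • G).comap (Algebra.linearMap A K)).FG := by
    refine Submodule.fg_of_fg_map_injective (Algebra.linearMap A K) (IsFractionRing.injective A K) ?_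
    rw [hmap]
    exact hG.map _
  obtain ⟨t, ht⟩ := hfg
  exact ⟨d, nonZeroDivisors.ne_zero hd, t, by rw [← hmap, ← ht]; rfl⟩

end Submodules

section HomogeneousFractional

variable {Γ : Type*} [AddCommMonoid Γ] [LinearOrder Γ]
variable {A : Type*} [CommRing A]
variable {K : Type*} [Field K] [Algebra A K]
variable {𝒜 : Γ → AddSubgroup A} [GradedRing 𝒜]

theorem IsHomog.isHomogeneous_span {s : A} (hs : IsHomog 𝒜 s) :
    (Ideal.span {s}).IsHomogeneous 𝒜 :=
  Ideal.homogeneous_span 𝒜 _ (by rintro _ rfl; exact hs.2)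

theorem IsHomogFrac.memRH {E : Submodule A K} (hE : IsHomogFrac 𝒜 E) {x : K} (hx : x ∈ E) :
    MemRH 𝒜 x := by
  obtain ⟨s, hs, I, -, hE⟩ := hE
  have hsx := Submodule.smul_mem_pointwise_smul x (algebraMap A K s) E hx
  rw [hE] at hsx
  obtain ⟨a, -, ha⟩ := hsx
  exact ⟨a, s, hs, by rw [mul_comm]; exact ha.symm⟩

variable [IsDomain A]

theorem IsHomogFrac.idealToK {I : Ideal A} (hI : I.IsHomogeneous 𝒜) :
    IsHomogFrac 𝒜 (idealToK (K := K) I) :=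
  ⟨1, ⟨one_ne_zero, 0, SetLike.one_mem_graded 𝒜⟩, I, hI, by rw [map_one, one_smul]⟩

theorem IsHomogFrac.mul {E F : Submodule A K} (hE : IsHomogFrac 𝒜 E) (hF : IsHomogFrac 𝒜 F) :
    IsHomogFrac 𝒜 (E * F) := by
  obtain ⟨s, ⟨hs0, i, hs⟩, I, hI, hE⟩ := hE
  obtain ⟨t, ⟨ht0, j, ht⟩, J, hJ, hF⟩ := hF
  refine ⟨s * t, ⟨mul_ne_zero hs0 ht0, i + j, SetLike.mul_mem_graded hs ht⟩, I * J, hI.mul hJ, ?_⟩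
  rw [map_mul, mul_smul_mul_eq, hE, hF, idealToK_mul]

theorem IsHomogFrac.pow {E : Submodule A K} (hE : IsHomogFrac 𝒜 E) (n : ℕ) :
    IsHomogFrac 𝒜 (E ^ n) := by
  induction n with
  | zero =>
    rw [pow_zero, ← idealToK_top]
    exact IsHomogFrac.idealToK (Ideal.IsHomogeneous.top 𝒜)
  | succ n ih => exact pow_succ E n ▸ ih.mul hE

theorem IsHomogFrac.smul {s : A} (hs : IsHomog 𝒜 s) {E : Submodule A K} (hE : IsHomogFrac 𝒜 E) :
    IsHomogFrac 𝒜 (algebraMap A K s • E) := by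
  rw [← Submodule.span_singleton_mul, ← idealToK_span_singleton]
  exact (IsHomogFrac.idealToK hs.isHomogeneous_span).mul hE

/-- A homogeneous fractional ideal contains the homogeneous components of its integral elements. -/
theorem IsHomogFrac.idealToK_contentIdeal_le [IsFractionRing A K] [IsOrderedCancelAddMonoid Γ]
    {E : Submodule A K} (hE : IsHomogFrac 𝒜 E) {c : A} (hc : algebraMap A K c ∈ E) :
    _root_.idealToK (coaction 𝒜 A c).contentIdeal ≤ E := by
  obtain ⟨t, ⟨ht0, τ, ht⟩, J, hJ, hE⟩ := hE
  have htK := algebraMap_ne_zero_of_ne_zero (K := K) ht0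
  have hmem : t * c ∈ J := by
    apply mem_of_algebraMap_mem_idealToK (K := K)
    rw [← hE, map_mul]
    exact Submodule.smul_mem_pointwise_smul _ _ E hc
  rw [← smul_le_smul_iff_of_ne_zero htK, hE, ← idealToK_span_singleton_mul]
  refine idealToK_mono ((Ideal.span_singleton_mul_le_iff).2 fun z hz => ?_)
  have hle : (coaction 𝒜 A c).contentIdeal ≤ Submodule.comap (LinearMap.mulLeft A t) J := by
    rw [AddMonoidAlgebra.contentIdeal_le_iff]
    intro γ
    rw [coeff_coaction]
    change t * (DirectSum.decompose 𝒜 c γ : A) ∈ J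
    rw [← decompose_mul_add_of_mem 𝒜 ht]
    exact hJ _ hmem
  exact hle hz

end HomogeneousFractional

section Semistar

variable {A : Type*} [CommRing A] {K : Type*} [Field K] [Algebra A K]
variable {star : Submodule A K → Submodule A K}

theorem IsSemistar.mul_star_le (h : IsSemistar star) (E : Submodule A K) {F : Submodule A K}
    (hF : F ≠ ⊥) : E * star F ≤ star (E * F) := by
  refine Submodule.mul_le.2 fun e he y hy => ?_
  rcases eq_or_ne e 0 with rfl | he0
  · simp
  have hmem : e * y ∈ e • star F := Submodule.smul_mem_pointwise_smul y e _ hy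
  rw [← h.1 e he0 F hF] at hmem
  exact h.2.1 _ _ (smul_submodule_ne_bot he0 hF) (smul_le_mul_of_mem he F) hmem

theorem IsSemistar.smul_star_le (h : IsSemistar star) {x : K} {E F : Submodule A K} (hE : E ≠ ⊥)
    (hF : F ≠ ⊥) (hx : x • E ≤ star F) : x • star E ≤ star F := by
  rcases eq_or_ne x 0 with rfl | hx0
  · rw [zero_smul]; exact bot_le
  rw [← h.1 x hx0 E hE, ← h.2.2.2 F hF]
  exact h.2.1 _ _ (smul_submodule_ne_bot hx0 hE) hx

theorem IsSemistar.pow_smul_le (h : IsSemistar star) {x : K} {F G : Submodule A K} (hF : F ≠ ⊥)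
    (hG : G ≠ ⊥) (hx : x • G ≤ star (F * G)) (n : ℕ) : x ^ n • G ≤ star (F ^ n * G) := by
  induction n with
  | zero => simpa using h.2.2.1 G hG
  | succ n ih =>
    have hn := mul_submodule_ne_bot (pow_submodule_ne_bot hF n) hG
    have hFG := mul_submodule_ne_bot hF hG
    rw [pow_succ', mul_smul]
    refine (Submodule.map_mono ih).trans (h.smul_star_le hn
      (mul_submodule_ne_bot (pow_submodule_ne_bot hF _) hG) ?_)
    rw [smul_mul_eq_mul_smul, pow_succ, mul_assoc]
    exact (mul_le_mul_right hx _).trans (h.mul_star_le _ hFG)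

end Semistar

section Main

variable {Γ : Type*} [AddCommMonoid Γ] [LinearOrder Γ] [IsOrderedCancelAddMonoid Γ]
variable {A : Type*} [CommRing A] [IsDomain A]
variable {K : Type*} [Field K] [Algebra A K] [IsFractionRing A K]
variable {𝒜 : Γ → AddSubgroup A} [GradedRing 𝒜]

theorem exists_homogFrac_smul_le_of_span {star : Submodule A K → Submodule A K}
    (hstar : IsSemistar star) (hhp : HomogPres 𝒜 star) {F : Submodule A K} (hF0 : F ≠ ⊥)
    (hF : IsHomogFrac 𝒜 F) {x : K} (hx0 : x ≠ 0) {t : Finset A}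
    (ht : Ideal.span (t : Set A) ≠ ⊥)
    (hx : x • idealToK (Ideal.span (t : Set A)) ≤
      star (F * idealToK (Ideal.span (t : Set A)))) :
    ∃ G : Submodule A K, G ≠ ⊥ ∧ G.FG ∧ IsHomogFrac 𝒜 G ∧ x • G ≤ star (F * G) := by
  set I := Ideal.span (t : Set A) with hI
  let C : Ideal A := ⨆ g ∈ t, (coaction 𝒜 A g).contentIdeal
  have hIC : I ≤ C := Ideal.span_le.2 fun g hg =>
    le_iSup₂ (f := fun g (_ : g ∈ t) => (coaction 𝒜 A g).contentIdeal) g hg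
      (mem_contentIdeal_coaction 𝒜 g)
  have hC0 : C ≠ ⊥ := ne_bot_of_le_ne_bot ht hIC
  have hCfg : C.FG := Submodule.fg_biSup t _ fun g _ => AddMonoidAlgebra.contentIdeal_fg _
  have hChom : C.IsHomogeneous 𝒜 :=
    Ideal.IsHomogeneous.iSup₂ fun g _ => isHomogeneous_contentIdeal_coaction 𝒜 g
  have hIK := idealToK_ne_bot (K := K) ht
  have hCK := idealToK_ne_bot (K := K) hC0
  have hmono : ∀ n, x ^ n • idealToK (K := K) I ≤ star (F ^ n * idealToK C) := fun n =>
    (hstar.pow_smul_le hF0 hIK hx n).trans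
      (hstar.2.1 _ _ (mul_submodule_ne_bot (pow_submodule_ne_bot hF0 n) hIK)
        (mul_le_mul_right (idealToK_mono hIC) _))
  have hhom : ∀ n, IsHomogFrac 𝒜 (star (F ^ n * idealToK C)) := fun n =>
    hhp _ (mul_submodule_ne_bot (pow_submodule_ne_bot hF0 n) hCK)
      ((hF.pow n).mul (IsHomogFrac.idealToK hChom))
  obtain ⟨a, s, hs, hxs⟩ : MemRH 𝒜 x := by
    obtain ⟨g, hg, hg0⟩ := (Submodule.ne_bot_iff _).1 ht
    exact memRH_of_forall_pow_mul 𝒜 hg0 fun n => (hhom n).memRH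
      (hmono n (Submodule.smul_mem_pointwise_smul _ _ _ (algebraMap_mem_idealToK hg)))
  have hsK := algebraMap_ne_zero_of_ne_zero (K := K) hs.1
  have ha0 : a ≠ 0 := by
    rintro rfl
    exact mul_ne_zero hx0 hsK (by rw [hxs, map_zero])
  set M := star (F * idealToK C)
  have hM : IsHomogFrac 𝒜 (algebraMap A K s • M) := by
    have h := hhom 1
    rw [pow_one] at h
    exact h.smul hs
  have hcontent : ∀ g ∈ t,
      idealToK (coaction 𝒜 A (a * g)).contentIdeal ≤ algebraMap A K s • M := by
    intro g hg
    refine hM.idealToK_contentIdeal_le ?_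
    have hxg : x * algebraMap A K g ∈ M := by
      have h := hmono 1 (Submodule.smul_mem_pointwise_smul _ _ _
        (algebraMap_mem_idealToK (Ideal.subset_span hg)))
      rwa [pow_one, pow_one] at h
    have h := Submodule.smul_mem_pointwise_smul _ (algebraMap A K s) _ hxg
    rwa [smul_eq_mul, ← mul_assoc, mul_comm _ x, hxs, ← map_mul] at h
  obtain ⟨N, hN⟩ := exists_forall_contentIdeal_pow_succ_mul_le 𝒜 a t
  set D := (coaction 𝒜 A a).contentIdeal
  have hD0 : D ^ N ≠ ⊥ := pow_ne_zero N (contentIdeal_coaction_ne_bot 𝒜 ha0)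
  have hDC0 : idealToK (K := K) (D ^ N * C) ≠ ⊥ := idealToK_ne_bot (mul_ne_zero hD0 hC0)
  refine ⟨idealToK (D ^ N * C), hDC0, ?_, ?_, ?_⟩
  · exact Submodule.FG.map _ (Ideal.FG.mul (AddMonoidAlgebra.contentIdeal_fg _).pow hCfg)
  · exact IsHomogFrac.idealToK
      (((isHomogeneous_contentIdeal_coaction 𝒜 a).pow 𝒜 N).mul hChom)
  rw [← smul_le_smul_iff_of_ne_zero hsK, smul_smul, mul_comm, hxs, ← idealToK_span_singleton_mul]
  have hle : Ideal.span {a} * (D ^ N * C) ≤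
      ⨆ g ∈ t, D ^ N * (coaction 𝒜 A (a * g)).contentIdeal := by
    rw [← mul_assoc]
    refine (Ideal.mul_mono_left (J := D ^ (N + 1)) ?_).trans ?_
    · rw [pow_succ']
      exact Ideal.mul_mono_left ((Ideal.span_singleton_le_iff_mem _).2
        (mem_contentIdeal_coaction 𝒜 a))
    · simp only [C, Ideal.mul_iSup]
      exact iSup₂_mono hN
  refine (idealToK_mono hle).trans (Submodule.map_le_iff_le_comap.2 (iSup₂_le fun g hg =>
    Submodule.map_le_iff_le_comap.1 ?_))
  change idealToK _ ≤ _
  rw [idealToK_mul, idealToK_mul, mul_left_comm]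
  refine (mul_le_mul_right (hcontent g hg) _).trans ?_
  rw [← smul_mul_eq_mul_smul]
  exact Submodule.map_mono (hstar.mul_star_le _ (mul_submodule_ne_bot hF0 hCK))

/-- Finitely generated submodules in the definition of `⋆_a` may be replaced by homogeneous ones. -/
theorem exists_homogFrac_smul_le {star : Submodule A K → Submodule A K}
    (hstar : IsSemistar star) (hhp : HomogPres 𝒜 star) {F : Submodule A K} (hF0 : F ≠ ⊥)
    (hF : IsHomogFrac 𝒜 F) {x : K} {G : Submodule A K} (hG0 : G ≠ ⊥) (hG : G.FG)
    (hx : x • G ≤ star (F * G)) :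
    ∃ G : Submodule A K, G ≠ ⊥ ∧ G.FG ∧ IsHomogFrac 𝒜 G ∧ x • G ≤ star (F * G) := by
  rcases eq_or_ne x 0 with rfl | hx0
  · refine ⟨idealToK ⊤, idealToK_ne_bot top_ne_bot,
      Submodule.FG.map _ (Module.Finite.fg_top (R := A)),
      IsHomogFrac.idealToK (Ideal.IsHomogeneous.top 𝒜), ?_⟩
    rw [zero_smul]
    exact bot_le
  obtain ⟨d, hd0, t, hdt⟩ := exists_smul_eq_idealToK_span hG
  have hdK := algebraMap_ne_zero_of_ne_zero (K := K) hd0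
  refine exists_homogFrac_smul_le_of_span hstar hhp hF0 hF hx0 (t := t) ?_ ?_
  · intro h
    apply smul_submodule_ne_bot hdK hG0
    rw [hdt, h, idealToK, Submodule.map_bot]
  · rw [← hdt, smul_comm, ← smul_mul_eq_mul_smul, hstar.1 _ hdK _ (mul_submodule_ne_bot hF0 hG0)]
    exact Submodule.map_mono hx

end Main

theorem isOrderedCancelAddMonoid_of_covariantClass_lt (Γ : Type*) [AddCommMonoid Γ] [LinearOrder Γ]
    [CovariantClass Γ Γ (· + ·) (· < ·)] : IsOrderedCancelAddMonoid Γ := by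
  have hlt : ∀ a b c : Γ, b < c → a + b < a + c := fun a _ _ h => CovariantClass.elim a h
  have hle : ∀ a b c : Γ, b ≤ c → a + b ≤ a + c := fun a b c h =>
    h.eq_or_lt.elim (fun h => h ▸ le_rfl) fun h => (hlt a b c h).le
  refine { add_le_add_left := fun a b h c => ?_, le_of_add_le_add_left := fun a b c h => ?_ }
  · simpa only [add_comm _ c] using hle c a b h
  · exact le_of_not_gt fun hlt' => (hlt a c b hlt').not_ge h

/-- If `⋆` is a homogeneous preserving semistar operation on the graded
domain `R`, then for every nonzero finitely generated homogeneous fractional ideal `F`,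
`F^{⋆_a} = ⋃ {((FG)^⋆ : G^⋆) : G nonzero f.g. homogeneous fractional ideal} = F^{⋆_{a(h)}}`. -/
theorem starA_eq_starAH_on_homog
    {Γ : Type*} [AddCommMonoid Γ] [LinearOrder Γ]
    [CovariantClass Γ Γ (· + ·) (· < ·)] [Nontrivial Γ]
    {A : Type*} [CommRing A] [IsDomain A]
    {K : Type*} [Field K] [Algebra A K] [IsFractionRing A K]
    (𝒜 : Γ → AddSubgroup A) [GradedRing 𝒜]
    (star stara starah : Submodule A K → Submodule A K)
    (hstar : IsSemistar star) (hhp : HomogPres 𝒜 star)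
    (ha : ∀ E : Submodule A K, E ≠ ⊥ → ∀ x : K, x ∈ stara E ↔ MemStarA star E x)
    (hah : ∀ E : Submodule A K, E ≠ ⊥ → ∀ x : K, x ∈ starah E ↔ MemStarAH 𝒜 star E x) :
    ∀ F : Submodule A K, F ≠ ⊥ → F.FG → IsHomogFrac 𝒜 F →
      ((stara F : Set K) = {x : K | ∃ G : Submodule A K, G ≠ ⊥ ∧ G.FG ∧ IsHomogFrac 𝒜 G ∧
          ∀ y ∈ star G, x * y ∈ star (F * G)}) ∧
      stara F = starah F := by
  intro F hF0 hFfg hF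
  have := isOrderedCancelAddMonoid_of_covariantClass_lt Γ
  have hkey : ∀ x : K, MemStarA star F x → ∃ G : Submodule A K, G ≠ ⊥ ∧ G.FG ∧
      IsHomogFrac 𝒜 G ∧ ∀ y ∈ star G, x * y ∈ star (F * G) := by
    rintro x ⟨F', hF'0, -, hF'F, G, hG0, hG, hx⟩
    have hxG : x • G ≤ star (F * G) := by
      rintro _ ⟨y, hy, rfl⟩
      exact hstar.2.1 _ _ (mul_submodule_ne_bot hF'0 hG0) (mul_le_mul_left hF'F _)
        (hx y (hstar.2.2.1 G hG0 hy))
    obtain ⟨G', hG'0, hG'fg, hG', hxG'⟩ := exists_homogFrac_smul_le hstar hhp hF0 hF hG0 hG hxG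
    exact ⟨G', hG'0, hG'fg, hG', fun y hy =>
      hstar.smul_star_le hG'0 (mul_submodule_ne_bot hF0 hG'0) hxG'
        (Submodule.smul_mem_pointwise_smul y x _ hy)⟩
  constructor
  · ext x
    rw [SetLike.mem_coe, ha F hF0]
    exact ⟨hkey x, fun ⟨G, hG0, hG, _, hx⟩ => ⟨F, hF0, hFfg, le_rfl, G, hG0, hG, hx⟩⟩
  · ext x
    rw [ha F hF0, hah F hF0]
    exact ⟨fun h => ⟨F, hF0, hFfg, le_rfl, hkey x h⟩,
      fun ⟨F', hF'0, hF', hle, G, hG0, hG, _, hx⟩ => ⟨F', hF'0, hF', hle, G, hG0, hG, hx⟩⟩
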